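/- Let a and b be the automorphisms of the binary rooted tree {0,1}^* defined recursively by a(0w) = 1·b(w), a(1w) = 0w, b(0w) = 0·a(w), b(1w) = 1w, and let G = ⟨a, b⟩. Let F be the free group on two generators u, v and π : F → G the surjective homomorphism with π(u) = a, π(v) = b. Then the kernel of π is the normal closure in F of the set of elements [[u^{2^k}, v^{2^k}], v^{2^k}] and [[v^{2^k}, u^{2^{k+1}}], u^{2^{k+1}}] for k ≥ 0, where [x, y] = x⁻¹y⁻¹xy; that is, G has the presentation ⟨a, b | [[a^{2^k}, b^{2^k}], b^{2^k}], [[b^{2^k}, a^{2^{k+1}}], a^{2^{k+1}}], k ≥ 0⟩. -/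

import Mathlib

mutual
  /-- `a(0w) = 1·b(w)`, `a(1w) = 0w` (`false = 0`, `true = 1`). -/
  def aFun : List Bool → List Bool
    | [] => []
    | false :: w => true :: bFun w
    | true :: w => false :: w
  /-- `b(0w) = 0·a(w)`, `b(1w) = 1w`. -/
  def bFun : List Bool → List Bool
    | [] => []
    | false :: w => false :: aFun w
    | true :: w => true :: w
end

mutual
  /-- The inverse of `aFun`. -/
  def aInv : List Bool → List Bool
    | [] => []
    | true :: w => false :: bInv w
    | false :: w => true :: w
  /-- The inverse of `bFun`. -/
  def bInv : List Bool → List Bool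
    | [] => []
    | false :: w => false :: aInv w
    | true :: w => true :: w
end

lemma left_inv_ab : ∀ w : List Bool, aInv (aFun w) = w ∧ bInv (bFun w) = w := by
  intro w
  induction w with
  | nil => exact ⟨rfl, rfl⟩
  | cons x t ih =>
    cases x
    · exact ⟨by simp [aFun, aInv, ih.2], by simp [bFun, bInv, ih.1]⟩
    · exact ⟨by simp [aFun, aInv], by simp [bFun, bInv]⟩

lemma right_inv_ab : ∀ w : List Bool, aFun (aInv w) = w ∧ bFun (bInv w) = w := by
  intro w
  induction w with
  | nil => exact ⟨rfl, rfl⟩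
  | cons x t ih =>
    cases x
    · exact ⟨by simp [aFun, aInv], by simp [bFun, bInv, ih.1]⟩
    · exact ⟨by simp [aFun, aInv, ih.2], by simp [bFun, bInv]⟩

/-- The automorphism `a` of the binary rooted tree. -/
def aPerm : Equiv.Perm (List Bool) :=
  ⟨aFun, aInv, fun w => (left_inv_ab w).1, fun w => (right_inv_ab w).1⟩

/-- The automorphism `b` of the binary rooted tree. -/
def bPerm : Equiv.Perm (List Bool) :=
  ⟨bFun, bInv, fun w => (left_inv_ab w).2, fun w => (right_inv_ab w).2⟩

/-- The commutator `[x, y] = x⁻¹y⁻¹xy`. -/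
def commutatorWord {G : Type*} [Group G] (x y : G) : G := x⁻¹ * y⁻¹ * x * y

open FreeGroup (of norm_mul_le isReduced_toWord toWord_eq_nil_iff)

/-- The action of the free group on the tree: `u = of true` acts as `a`, `v = of false` as `b`. -/
def evalTree : FreeGroup Bool →* Equiv.Perm (List Bool) :=
  FreeGroup.lift fun i : Bool => if i then aPerm else bPerm

/-- The defining relators of the presentation. -/
def relators : Set (FreeGroup Bool) :=
  {w : FreeGroup Bool | ∃ k : ℕ,
    w = commutatorWord (commutatorWord ((FreeGroup.of true) ^ 2 ^ k) ((FreeGroup.of false) ^ 2 ^ k))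
          ((FreeGroup.of false) ^ 2 ^ k) ∨
    w = commutatorWord (commutatorWord ((FreeGroup.of false) ^ 2 ^ k)
          ((FreeGroup.of true) ^ 2 ^ (k + 1))) ((FreeGroup.of true) ^ 2 ^ (k + 1))}

/-- The substitution `u ↦ v`, `v ↦ u²`, which preserves the set of relators. -/
def doubling : FreeGroup Bool →* FreeGroup Bool :=
  FreeGroup.lift fun i : Bool => if i then FreeGroup.of false else FreeGroup.of true ^ 2

lemma map_commutatorWord {G H : Type*} [Group G] [Group H] (f : G →* H) (x y : G) :
    f (commutatorWord x y) = commutatorWord (f x) (f y) := by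
  simp [commutatorWord]

lemma doubling_of_true : doubling (of true) = of false := by simp [doubling]

lemma doubling_of_false : doubling (of false) = of true ^ 2 := by simp [doubling]

lemma sq_pow_two_pow {G : Type*} [Group G] (x : G) (k : ℕ) : (x ^ 2) ^ 2 ^ k = x ^ 2 ^ (k + 1) := by
  rw [← pow_mul, pow_succ']

lemma doubling_mem_relators {w : FreeGroup Bool} (hw : w ∈ relators) : doubling w ∈ relators := by
  obtain ⟨k, rfl | rfl⟩ := hw
  · refine ⟨k, Or.inr ?_⟩
    simp only [map_commutatorWord, map_pow, doubling_of_true, doubling_of_false, sq_pow_two_pow]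
  · refine ⟨k + 1, Or.inl ?_⟩
    simp only [map_commutatorWord, map_pow, doubling_of_true, doubling_of_false, sq_pow_two_pow]

/-- A homomorphism that kills `u` kills all relators. -/
lemma map_relators_of_map_true {H : Type*} [Group H] (f : FreeGroup Bool →* H)
    (hf : f (of true) = 1) {w : FreeGroup Bool} (hw : w ∈ relators) : f w = 1 := by
  obtain ⟨k, rfl | rfl⟩ := hw <;> simp [hf, commutatorWord]

/-! ### The relators hold in the tree automorphism group -/

lemma aFun_aInv (w : List Bool) : aFun (aInv w) = w := (right_inv_ab w).1
lemma aInv_aFun (w : List Bool) : aInv (aFun w) = w := (left_inv_ab w).1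
lemma bInv_bFun (w : List Bool) : bInv (bFun w) = w := (left_inv_ab w).2

lemma aPerm_apply (w : List Bool) : aPerm w = aFun w := rfl
lemma bPerm_apply (w : List Bool) : bPerm w = bFun w := rfl
lemma aPerm_symm_apply (w : List Bool) : aPerm.symm w = aInv w := rfl
lemma bPerm_symm_apply (w : List Bool) : bPerm.symm w = bInv w := rfl

lemma evalTree_of_true : evalTree (of true) = aPerm := by simp [evalTree]
lemma evalTree_of_false : evalTree (of false) = bPerm := by simp [evalTree]

lemma commutatorWord_aPerm_bPerm :
    commutatorWord (commutatorWord aPerm bPerm) bPerm = 1 := by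
  ext1 w
  rcases w with _ | ⟨_ | _, w⟩ <;>
    simp [commutatorWord, aPerm_apply, bPerm_apply, aPerm_symm_apply, bPerm_symm_apply, aFun, bFun,
      aInv, bInv, aFun_aInv, aInv_aFun, bInv_bFun]

lemma evalTree_nil (w : FreeGroup Bool) : evalTree w [] = [] := by
  induction w using FreeGroup.induction_on with
  | C1 => simp
  | of x => cases x <;> rfl
  | inv_of x _ => cases x <;> rfl
  | mul x y hx hy => simp [hx, hy]

/-- The homomorphism `u ↦ 1`, `v ↦ b` counting the exponent of `v`. -/
def evalExp : FreeGroup Bool →* Equiv.Perm (List Bool) :=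
  FreeGroup.lift fun i : Bool => if i then 1 else bPerm

lemma evalTree_doubling_cons (w : FreeGroup Bool) : ∀ t : List Bool,
    evalTree (doubling w) (false :: t) = false :: evalTree w t ∧
      evalTree (doubling w) (true :: t) = true :: evalExp w t := by
  induction w using FreeGroup.induction_on with
  | C1 => simp
  | of x => cases x <;> intro t <;> exact ⟨rfl, rfl⟩
  | inv_of x _ => cases x <;> intro t <;> exact ⟨rfl, rfl⟩
  | mul x y hx hy => intro t; simp [hx, hy]

lemma evalTree_doubling_eq_one {w : FreeGroup Bool} (hw : evalTree w = 1) (hw' : evalExp w = 1) :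
    evalTree (doubling w) = 1 := by
  ext1 t
  rcases t with _ | ⟨_ | _, t⟩
  · simp [evalTree_nil]
  · simp [(evalTree_doubling_cons w t).1, hw]
  · simp [(evalTree_doubling_cons w t).2, hw']

lemma evalTree_relators {w : FreeGroup Bool} (hw : w ∈ relators) : evalTree w = 1 := by
  have step : ∀ w ∈ relators, evalTree w = 1 → evalTree (doubling w) = 1 := fun w hw h =>
    evalTree_doubling_eq_one h (map_relators_of_map_true evalExp (by simp [evalExp]) hw)
  have key : ∀ k : ℕ, evalTree (commutatorWord (commutatorWord ((of true) ^ 2 ^ k)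
      ((of false) ^ 2 ^ k)) ((of false) ^ 2 ^ k)) = 1 ∧
      evalTree (commutatorWord (commutatorWord ((of false) ^ 2 ^ k)
          ((of true) ^ 2 ^ (k + 1))) ((of true) ^ 2 ^ (k + 1))) = 1 := by
    intro k
    have second : ∀ k : ℕ, evalTree (commutatorWord (commutatorWord ((of true) ^ 2 ^ k)
      ((of false) ^ 2 ^ k)) ((of false) ^ 2 ^ k)) = 1 →
      evalTree (commutatorWord (commutatorWord ((of false) ^ 2 ^ k)
          ((of true) ^ 2 ^ (k + 1))) ((of true) ^ 2 ^ (k + 1))) = 1 := by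
      intro k h
      have := step _ ⟨k, Or.inl rfl⟩ h
      simpa only [map_commutatorWord doubling, map_pow doubling, doubling_of_true, doubling_of_false,
        sq_pow_two_pow] using this
    induction k with
    | zero =>
      have h : evalTree (commutatorWord (commutatorWord ((of true) ^ 2 ^ 0)
          ((of false) ^ 2 ^ 0)) ((of false) ^ 2 ^ 0)) = 1 := by
        simpa only [pow_zero, pow_one, map_commutatorWord, evalTree_of_true, evalTree_of_false]
          using commutatorWord_aPerm_bPerm
      exact ⟨h, second 0 h⟩
    | succ k ih =>
      have h := step _ ⟨k, Or.inr rfl⟩ ih.2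
      simp only [map_commutatorWord doubling, map_pow doubling, doubling_of_true, doubling_of_false,
        sq_pow_two_pow] at h
      exact ⟨h, second _ h⟩
  obtain ⟨k, rfl | rfl⟩ := hw
  exacts [(key k).1, (key k).2]

/-! ### Sections of words -/

/-- The action of a word on the first level of the tree. -/
def act : List (Bool × Bool) → Bool → Bool
  | [], i => i
  | (true, _) :: L, i => !(act L i)
  | (false, _) :: L, i => act L i

/-- The section of a single letter at a vertex of the first level. -/
def letterSection : Bool × Bool → Bool → FreeGroup Bool
  | (true, true), false => of false
  | (true, false), true => (of false)⁻¹
  | (false, true), false => of true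
  | (false, false), false => (of true)⁻¹
  | _, _ => 1

/-- The section of a word at a vertex of the first level. -/
def wordSection : List (Bool × Bool) → Bool → FreeGroup Bool
  | [], _ => 1
  | x :: L, i => letterSection x (act L i) * wordSection L i

lemma mk_cons_true (c : Bool) (L : List (Bool × Bool)) :
    FreeGroup.mk ((c, true) :: L) = of c * FreeGroup.mk L := by
  rw [FreeGroup.of, FreeGroup.mul_mk]; rfl

lemma mk_cons_false (c : Bool) (L : List (Bool × Bool)) :
    FreeGroup.mk ((c, false) :: L) = (of c)⁻¹ * FreeGroup.mk L := by
  rw [FreeGroup.of, FreeGroup.inv_mk, FreeGroup.mul_mk]; rfl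

lemma evalTree_mk_cons (L : List (Bool × Bool)) (i : Bool) (w : List Bool) :
    evalTree (FreeGroup.mk L) (i :: w) = act L i :: evalTree (wordSection L i) w := by
  induction L with
  | nil => simp [act, wordSection, ← FreeGroup.one_eq_mk]
  | cons x L ih =>
    obtain ⟨_ | _, _ | _⟩ := x <;> cases hi : act L i <;>
      simp [mk_cons_true, mk_cons_false, ih, act, wordSection, hi, letterSection, aPerm_apply, bPerm_apply, aPerm_symm_apply, bPerm_symm_apply, aFun, bFun,
        aInv, bInv, evalTree_of_true, evalTree_of_false]

lemma norm_letterSection_add (x : Bool × Bool) :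
    (letterSection x false).norm + (letterSection x true).norm = 1 := by
  obtain ⟨_ | _, _ | _⟩ := x <;> simp [letterSection]

lemma norm_letterSection_le (x : Bool × Bool) (i : Bool) : (letterSection x i).norm ≤ 1 := by
  have := norm_letterSection_add x
  cases i <;> omega

lemma norm_wordSection_le (L : List (Bool × Bool)) (i : Bool) :
    (wordSection L i).norm ≤ L.length := by
  induction L with
  | nil => simp [wordSection]
  | cons x L ih =>
    have h₁ := norm_mul_le (letterSection x (act L i)) (wordSection L i)
    have h₂ := norm_letterSection_le x (act L i)
    simp only [wordSection, List.length_cons]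
    omega

/-- A reduced word with a section as long as itself is essentially a power of `v`. -/
lemma isReduced_of_length_le_norm_wordSection {i : Bool} {L : List (Bool × Bool)}
    (hL : FreeGroup.IsReduced L) (h : L.length ≤ (wordSection L i).norm) :
    (act L i = false → ∃ n : ℤ,
      FreeGroup.mk L = of false ^ n * bif i then (of true)⁻¹ else 1) ∧
    (act L i = true → L = [] ∨ (∃ L', L = (true, true) :: L') ∧ ∃ n : ℤ,
      FreeGroup.mk L = of true * of false ^ n * bif i then (of true)⁻¹ else 1) := by
  induction L with
  | nil => cases i <;> simpa [act, ← FreeGroup.one_eq_mk] using ⟨0, by simp⟩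
  | cons x L ih =>
    have hL' : FreeGroup.IsReduced L := hL.infix (List.suffix_cons x L).isInfix
    have h₁ := norm_mul_le (letterSection x (act L i)) (wordSection L i)
    have h₂ := norm_letterSection_le x (act L i)
    have h₃ := norm_wordSection_le L i
    simp only [wordSection, List.length_cons] at h
    have h₄ : (letterSection x (act L i)).norm = 1 := by omega
    obtain ⟨ih₁, ih₂⟩ := ih hL' (by omega)
    cases hi : act L i
    · obtain ⟨n, hn⟩ := ih₁ hi
      obtain ⟨_ | _, _ | _⟩ := x
      · refine ⟨fun _ => ⟨n - 1, ?_⟩, by simp [act, hi]⟩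
        rw [mk_cons_false, hn, ← mul_assoc]
        congr 1; group
      · refine ⟨fun _ => ⟨n + 1, ?_⟩, by simp [act, hi]⟩
        rw [mk_cons_true, hn, ← mul_assoc]
        congr 1; group
      · simp [hi, letterSection] at h₄
      · refine ⟨by simp [act, hi], fun _ => Or.inr ⟨⟨L, rfl⟩, n, ?_⟩⟩
        rw [mk_cons_true, hn, ← mul_assoc]
    · obtain ⟨_ | _, _ | _⟩ := x
      · simp [hi, letterSection] at h₄
      · simp [hi, letterSection] at h₄
      · refine ⟨fun _ => ?_, by simp [act, hi]⟩
        obtain rfl | ⟨⟨L', rfl⟩, -⟩ := ih₂ hi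
        · simp only [act] at hi
          refine ⟨0, ?_⟩
          simp [hi, mk_cons_false, ← FreeGroup.one_eq_mk]
        · simp [FreeGroup.IsReduced] at hL
      · simp [hi, letterSection] at h₄

lemma pow_eq_one_of_aPerm_bPerm (n : ℕ) :
    (aPerm ^ n = 1 → n = 0) ∧ (bPerm ^ n = 1 → n = 0) := by
  have hb : ∀ (n : ℕ) (w : List Bool), (bPerm ^ n) (false :: w) = false :: (aPerm ^ n) w := by
    intro n w
    induction n with
    | zero => simp
    | succ n ih => rw [pow_succ', pow_succ', Equiv.Perm.mul_apply, ih]; rfl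
  have ha : ∀ (n : ℕ) (w : List Bool),
      (aPerm ^ (2 * n)) (false :: w) = false :: (bPerm ^ n) w := by
    intro n w
    induction n with
    | zero => simp
    | succ n ih =>
      rw [mul_add, mul_one, pow_succ', pow_succ', pow_succ' bPerm, Equiv.Perm.mul_apply,
        Equiv.Perm.mul_apply, ih]
      rfl
  have hab : ∀ n, bPerm ^ n = 1 → aPerm ^ n = 1 := by
    intro n h
    ext1 w
    have := hb n w
    simpa [h] using this.symm
  have hodd : ∀ n, aPerm ^ (2 * n + 1) ≠ 1 := by
    intro n h
    have h₁ := ha n []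
    rw [pow_succ'] at h
    have h₂ := congrArg (fun f => f [false]) h
    simp only [Equiv.Perm.mul_apply, h₁] at h₂
    exact absurd h₂ (by simp [aPerm_apply, aFun])
  suffices h : ∀ n, aPerm ^ n = 1 → n = 0 from ⟨h n, fun h' => h n (hab n h')⟩
  intro n
  induction n using Nat.strong_induction_on with
  | _ n ih =>
    intro h
    obtain ⟨m, rfl | rfl⟩ := Nat.even_or_odd' n
    · have hm : bPerm ^ m = 1 := by
        ext1 w
        have := ha m w
        simpa [h] using this.symm
      by_contra hne
      exact hne (by rw [ih m (by omega) (hab m hm)])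
    · exact absurd h (hodd m)

lemma zpow_eq_zero_of_bPerm {n : ℤ} (h : bPerm ^ n = 1) : n = 0 := by
  obtain ⟨m, rfl | rfl⟩ := n.eq_nat_or_neg
  · simpa using (pow_eq_one_of_aPerm_bPerm m).2 (by simpa using h)
  · simpa using (pow_eq_one_of_aPerm_bPerm m).2 (by simpa using h)

lemma evalTree_of_false_zpow {n : ℤ} (h : evalTree (of false ^ n) = 1) :
    of false ^ n = (1 : FreeGroup Bool) := by
  rw [map_zpow, evalTree_of_false] at h
  rw [zpow_eq_zero_of_bPerm h, zpow_zero]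

/-! ### Words in the presented group are determined by their sections -/

section Presented

variable {Γ : Type*} [Group Γ]

lemma commute_conj_odd {a b : Γ} (h₁ : Commute b (a⁻¹ * b * a))
    (h₂ : Commute (a ^ 2) (b⁻¹ * a ^ 2 * b)) (n : ℤ) :
    Commute b ((a ^ 2) ^ (-n) * (a⁻¹ * b * a) * (a ^ 2) ^ n) := by
  set s := a ^ 2 with hs
  set c := s⁻¹ * b⁻¹ * s * b with hc
  have hsc : Commute s c := by
    have : c = s⁻¹ * (b⁻¹ * s * b) := by rw [hc]; group
    rw [this]
    exact ((Commute.refl s).inv_right).mul_right h₂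
  have h₀ : Commute (a⁻¹ * b * a) b := h₁.symm
  have h₃ : Commute (a⁻¹ * b * a) (s⁻¹ * b * s) := by
    have := (Commute.conj_iff a⁻¹).2 h₁
    have e : a⁻¹ * (a⁻¹ * b * a) * a⁻¹⁻¹ = s⁻¹ * b * s := by
      simp only [hs, pow_two, mul_inv_rev, inv_inv, mul_assoc]
    rwa [e, inv_inv] at this
  have h₄ : Commute (a⁻¹ * b * a) c := by
    have : c = (s⁻¹ * b * s)⁻¹ * b := by rw [hc]; group
    rw [this]
    exact h₃.inv_right.mul_right h₀
  have hpow : ∀ m : ℤ, s ^ (-m) * b * s ^ m = b * c ^ (-m) := by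
    have hstep : s⁻¹ * b * s = b * c⁻¹ := by rw [hc]; group
    have hcs : ∀ k : ℤ, c ^ k * s = s * c ^ k := fun k => ((hsc.symm).zpow_left k).eq
    intro m
    induction m with
    | zero => simp
    | succ m ih =>
      calc s ^ (-((m : ℤ) + 1)) * b * s ^ ((m : ℤ) + 1)
          = s⁻¹ * (s ^ (-(m : ℤ)) * b * s ^ (m : ℤ)) * s := by group
        _ = s⁻¹ * b * s * c ^ (-(m : ℤ)) := by rw [ih]; simp only [mul_assoc, hcs]
        _ = b * c ^ (-((m : ℤ) + 1)) := by rw [hstep]; group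
    | pred m ih =>
      calc s ^ (-(-(m : ℤ) - 1)) * b * s ^ (-(m : ℤ) - 1)
          = s * (s ^ (-(-(m : ℤ))) * b * s ^ (-(m : ℤ))) * s⁻¹ := by group
        _ = s * b * s⁻¹ * (s * c ^ (-(-(m : ℤ))) * s⁻¹) := by rw [ih]; group
        _ = s * (b * c⁻¹) * s⁻¹ * c * c ^ (-(-(m : ℤ))) := by
          rw [← hcs, mul_inv_cancel_right]
          have : c⁻¹ * s⁻¹ * c = s⁻¹ := by
            rw [mul_assoc, ((hsc.inv_left).eq), inv_mul_cancel_left]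
          calc s * b * s⁻¹ * c ^ (-(-(m : ℤ)))
              = s * b * (c⁻¹ * s⁻¹ * c) * c ^ (-(-(m : ℤ))) := by rw [this]
            _ = _ := by simp only [mul_assoc]
        _ = b * c ^ (-(-(m : ℤ) - 1)) := by rw [← hstep]; group
  have key : Commute (a⁻¹ * b * a) (s ^ n * b * s ^ (-n)) := by
    have := hpow (-n)
    rw [neg_neg] at this
    rw [this]
    exact h₀.mul_right (h₄.zpow_right n)
  have := (Commute.conj_iff (s ^ (-n))).2 key
  have e : s ^ (-n) * (s ^ n * b * s ^ (-n)) * (s ^ (-n))⁻¹ = b := by group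
  rw [e] at this
  simpa using this.symm

/-- The homomorphism `u ↦ b`, `v ↦ a²`. -/
def doublingTo (a b : Γ) : FreeGroup Bool →* Γ :=
  FreeGroup.lift fun i : Bool => if i then b else a ^ 2

/-- The homomorphism `u ↦ 1`, `v ↦ a²`. -/
def squareTo (a : Γ) : FreeGroup Bool →* Γ :=
  FreeGroup.lift fun i : Bool => if i then 1 else a ^ 2

lemma commute_doublingTo {a b : Γ} (h₁ : Commute b (a⁻¹ * b * a))
    (h₂ : Commute (a ^ 2) (b⁻¹ * a ^ 2 * b)) (y : FreeGroup Bool) : ∀ n : ℤ,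
    Commute (doublingTo a b y * (squareTo a y)⁻¹)
      ((a ^ 2) ^ (-n) * (a⁻¹ * b * a) * (a ^ 2) ^ n) := by
  have hb := commute_conj_odd h₁ h₂
  have conj : ∀ (z : Γ) (m n : ℤ), Commute z ((a ^ 2) ^ (-(n + m)) * (a⁻¹ * b * a) *
      (a ^ 2) ^ (n + m)) → Commute ((a ^ 2) ^ m * z * (a ^ 2) ^ (-m))
        ((a ^ 2) ^ (-n) * (a⁻¹ * b * a) * (a ^ 2) ^ n) := by
    intro z m n h
    have := (Commute.conj_iff ((a ^ 2) ^ m)).2 h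
    have e : (a ^ 2) ^ m * ((a ^ 2) ^ (-(n + m)) * (a⁻¹ * b * a) * (a ^ 2) ^ (n + m)) *
        ((a ^ 2) ^ m)⁻¹ = (a ^ 2) ^ (-n) * (a⁻¹ * b * a) * (a ^ 2) ^ n := by
      simp only [zpow_add, zpow_neg, neg_add]; group
    rwa [e, ← zpow_neg] at this
  have hz : ∀ z : FreeGroup Bool, ∃ m : ℤ, squareTo a z = (a ^ 2) ^ m := by
    intro z
    induction z using FreeGroup.induction_on with
    | C1 => exact ⟨0, by simp⟩
    | of x => cases x
              · exact ⟨1, by simp [squareTo]⟩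
              · exact ⟨0, by simp [squareTo]⟩
    | inv_of x h => obtain ⟨m, h⟩ := h; exact ⟨-m, by rw [map_inv, h, zpow_neg]⟩
    | mul x y hx hy =>
      obtain ⟨m, hx⟩ := hx
      obtain ⟨k, hy⟩ := hy
      exact ⟨m + k, by rw [map_mul, hx, hy, zpow_add]⟩
  induction y using FreeGroup.induction_on with
  | C1 => simp
  | of x =>
    intro n
    cases x
    · simp [doublingTo, squareTo]
    · simpa [doublingTo, squareTo] using hb n
  | inv_of x _ =>
    intro n
    cases x
    · simp [doublingTo, squareTo]
    · simpa [doublingTo, squareTo] using (hb n).inv_left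
  | mul x y hx hy =>
    intro n
    obtain ⟨m, hm⟩ := hz x
    have e : doublingTo a b (x * y) * (squareTo a (x * y))⁻¹ =
        (doublingTo a b x * (squareTo a x)⁻¹) *
          ((a ^ 2) ^ m * (doublingTo a b y * (squareTo a y)⁻¹) * (a ^ 2) ^ (-m)) := by
      simp only [map_mul, mul_inv_rev, hm, zpow_neg]; group
    rw [e]
    exact (hx n).mul_left (conj _ _ _ (hy _))

/-- The element of the presented group with given sections. -/
def reconstruct (a b : Γ) (y z : FreeGroup Bool) : Γ :=
  doublingTo a b y * (squareTo a y)⁻¹ * (a⁻¹ * doublingTo a b z * a)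

lemma reconstruct_wordSection {a b : Γ} (h₁ : Commute b (a⁻¹ * b * a))
    (h₂ : Commute (a ^ 2) (b⁻¹ * a ^ 2 * b)) {f : FreeGroup Bool →* Γ}
    (ha : f (of true) = a) (hb : f (of false) = b) (L : List (Bool × Bool)) :
    (act L false = false → act L true = true ∧
      f (FreeGroup.mk L) = reconstruct a b (wordSection L false) (wordSection L true)) ∧
    (act L false = true → act L true = false ∧
      a⁻¹ * f (FreeGroup.mk L) =
        reconstruct a b ((of false)⁻¹ * wordSection L false) (wordSection L true)) := by
  have hv : doublingTo a b (of false) = a ^ 2 := by simp [doublingTo]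
  have hu : doublingTo a b (of true) = b := by simp [doublingTo]
  have hv' : squareTo a (of false) = a ^ 2 := by simp [squareTo]
  have hu' : squareTo a (of true) = 1 := by simp [squareTo]
  have hcomm : ∀ y : FreeGroup Bool, Commute (doublingTo a b y * (squareTo a y)⁻¹)
      (a⁻¹ * b * a) := fun y => by simpa using commute_doublingTo h₁ h₂ y 0
  have mul_u : ∀ y z, reconstruct a b (of true * y) z = b * reconstruct a b y z := by
    intro y z; simp only [reconstruct, map_mul, hu, hu', one_mul, mul_assoc]
  have inv_u : ∀ y z, reconstruct a b ((of true)⁻¹ * y) z = b⁻¹ * reconstruct a b y z := by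
    intro y z
    simp only [reconstruct, map_mul, map_inv, hu, hu', one_mul, mul_assoc, inv_one]
  have mul_v : ∀ y z, reconstruct a b y (of false * z) =
      a ^ 2 * reconstruct a b ((of false)⁻¹ * y) z := by
    intro y z
    simp only [reconstruct, map_mul, map_inv, hv, hv', mul_inv_rev, inv_inv]
    group
  have inv_v : ∀ y z, reconstruct a b ((of false)⁻¹ * y) ((of false)⁻¹ * z) =
      a⁻¹ * a⁻¹ * reconstruct a b y z := by
    intro y z
    simp only [reconstruct, map_mul, map_inv, hv, hv', mul_inv_rev, inv_inv]
    group
  have mul_u' : ∀ y z, reconstruct a b y (of true * z) =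
      a⁻¹ * b * a * reconstruct a b y z := by
    intro y z
    rw [reconstruct, reconstruct, ← mul_assoc _ (doublingTo a b y * _), ← (hcomm y).eq, map_mul, hu]
    group
  have inv_u' : ∀ y z, reconstruct a b y ((of true)⁻¹ * z) =
      a⁻¹ * b⁻¹ * a * reconstruct a b y z := by
    intro y z
    have := mul_u' y ((of true)⁻¹ * z)
    rw [mul_inv_cancel_left] at this
    rw [this]
    group
  induction L with
  | nil => simp [act, wordSection, reconstruct, ← FreeGroup.one_eq_mk]
  | cons x L ih =>
    cases hi : act L false
    · obtain ⟨h, e⟩ := ih.1 hi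
      obtain ⟨_ | _, _ | _⟩ := x
      · simp [act, wordSection, letterSection, hi, h, mk_cons_false, hb, e, inv_u]
      · simp [act, wordSection, letterSection, hi, h, mk_cons_true, hb, e, mul_u]
      · simp [act, wordSection, letterSection, hi, h, mk_cons_false, ha, e, inv_v,
          mul_assoc]
      · simp [act, wordSection, letterSection, hi, h, mk_cons_true, ha, e]
    · obtain ⟨h, e⟩ := ih.2 hi
      have e' := eq_mul_of_inv_mul_eq e
      obtain ⟨_ | _, _ | _⟩ := x
      · simp [act, wordSection, letterSection, hi, h, mk_cons_false, hb, e',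
          inv_u', mul_assoc]
      · simp [act, wordSection, letterSection, hi, h, mk_cons_true, hb, e',
          mul_u', mul_assoc]
      · simp [act, wordSection, letterSection, hi, h, mk_cons_false, ha, e]
      · simp [act, wordSection, letterSection, hi, h, mk_cons_true, ha, e',
          mul_v, pow_two, mul_assoc]

end Presented

lemma commute_of_commutatorWord {H : Type*} [Group H] {x y : H}
    (h : commutatorWord (commutatorWord x y) y = 1) : Commute y (x⁻¹ * y * x) := by
  have e : Commute (commutatorWord x y) y := by
    rw [commutatorWord, mul_assoc, mul_eq_one_iff_eq_inv] at h
    have := congrArg (·⁻¹) h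
    simp only [mul_inv_rev, inv_inv] at this
    exact this.symm
  have : x⁻¹ * y * x = (commutatorWord x y * y⁻¹)⁻¹ := by
    simp [commutatorWord, mul_assoc]
  rw [this]
  exact ((e.symm).mul_right (Commute.refl y).inv_right).inv_right

lemma doubling_mem {w : FreeGroup Bool} (hw : w ∈ Subgroup.normalClosure relators) :
    doubling w ∈ Subgroup.normalClosure relators := by
  have : Subgroup.normalClosure relators ≤
      (Subgroup.normalClosure relators).comap doubling :=
    Subgroup.normalClosure_le_normal fun w hw =>
      Subgroup.subset_normalClosure (doubling_mem_relators hw)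
  exact this hw

lemma mem_normalClosure_of_wordSection {L : List (Bool × Bool)} (hL : act L false = false)
    (h : ∀ i, wordSection L i ∈ Subgroup.normalClosure relators) :
    FreeGroup.mk L ∈ Subgroup.normalClosure relators := by
  set q := QuotientGroup.mk' (Subgroup.normalClosure relators) with hq
  have hq1 : ∀ w, q w = 1 ↔ w ∈ Subgroup.normalClosure relators := fun w => by
    rw [← MonoidHom.mem_ker, hq, QuotientGroup.ker_mk']
  have hrel : ∀ w ∈ relators, q w = 1 := fun w hw =>
    (hq1 w).2 (Subgroup.subset_normalClosure hw)
  have h₁ : Commute (q (of false)) ((q (of true))⁻¹ * q (of false) * q (of true)) := by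
    apply commute_of_commutatorWord
    simpa [map_commutatorWord] using hrel _ ⟨0, Or.inl rfl⟩
  have h₂ : Commute (q (of true) ^ 2) ((q (of false))⁻¹ * q (of true) ^ 2 * q (of false)) := by
    apply commute_of_commutatorWord
    simpa only [map_commutatorWord, pow_zero, pow_one, zero_add, map_pow] using
      hrel _ ⟨0, Or.inr rfl⟩
  have hd : ∀ w ∈ Subgroup.normalClosure relators,
      doublingTo (q (of true)) (q (of false)) w = 1 := by
    have e : doublingTo (q (of true)) (q (of false)) = q.comp doubling := by
      ext i
      cases i <;> simp [doublingTo, doubling]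
    intro w hw
    rw [e]
    exact (hq1 _).2 (doubling_mem hw)
  have hs : ∀ w ∈ Subgroup.normalClosure relators, squareTo (q (of true)) w = 1 := by
    have : Subgroup.normalClosure relators ≤ (squareTo (q (of true))).ker :=
      Subgroup.normalClosure_le_normal fun w hw =>
        map_relators_of_map_true _ (by simp [squareTo]) hw
    exact this
  rw [← hq1, ((reconstruct_wordSection h₁ h₂ rfl rfl L).1 hL).2, reconstruct, hd _ (h _),
    hs _ (h _), hd _ (h _)]
  simp

lemma mem_normalClosure_of_evalTree (n : ℕ) : ∀ x : FreeGroup Bool, x.norm = n →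
    evalTree x = 1 → x ∈ Subgroup.normalClosure relators := by
  induction n using Nat.strong_induction_on with
  | _ n ih =>
    intro x hn hx
    have hmk : FreeGroup.mk x.toWord = x := FreeGroup.mk_toWord
    have hsec : ∀ i, act x.toWord i = i ∧ evalTree (wordSection x.toWord i) = 1 := by
      intro i
      have h := evalTree_mk_cons x.toWord i
      rw [hmk, hx] at h
      refine ⟨(List.cons_eq_cons.1 (h [])).1.symm, ?_⟩
      ext1 w
      exact (List.cons_eq_cons.1 (h w)).2.symm
    by_cases hlt : ∀ i, (wordSection x.toWord i).norm < n
    · rw [← hmk]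
      exact mem_normalClosure_of_wordSection (hsec false).1
        fun i => ih _ (hlt i) _ rfl (hsec i).2
    · push Not at hlt
      obtain ⟨i, hi⟩ := hlt
      suffices x = 1 by rw [this]; exact one_mem _
      obtain ⟨h₁, h₂⟩ := isReduced_of_length_le_norm_wordSection
        (isReduced_toWord (x := x)) (i := i) (by rwa [← hn] at hi)
      rw [hmk] at h₁ h₂
      cases i
      · obtain ⟨m, hm⟩ := h₁ (hsec false).1
        simp only [cond_false, mul_one] at hm
        rw [hm] at hx ⊢
        exact evalTree_of_false_zpow hx
      · obtain h | ⟨-, m, hm⟩ := h₂ (hsec true).1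
        · exact toWord_eq_nil_iff.1 h
        · simp only [cond_true] at hm
          rw [hm] at hx ⊢
          rw [map_mul, map_mul, map_inv, conj_eq_one_iff] at hx
          rw [conj_eq_one_iff, evalTree_of_false_zpow hx]

/-- Presentation of `IMG(z² − 1) = ⟨a, b⟩` (L. Bartholdi): with
`π : F₂ = FreeGroup Bool → Aut({0,1}^*)` sending `u = of true ↦ a`,
`v = of false ↦ b`, the homomorphism `π` maps onto `⟨a, b⟩` and its kernel is
the normal closure of the elements `[[u^{2^k}, v^{2^k}], v^{2^k}]` and
`[[v^{2^k}, u^{2^{k+1}}], u^{2^{k+1}}]`, `k ≥ 0`; i.e.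
`G = ⟨a, b ∣ [[a^{2^k}, b^{2^k}], b^{2^k}], [[b^{2^k}, a^{2^{k+1}}], a^{2^{k+1}}], k ≥ 0⟩`. -/
theorem statement15 :
    (FreeGroup.lift fun i : Bool => if i then aPerm else bPerm).range =
      Subgroup.closure {aPerm, bPerm} ∧
    (FreeGroup.lift fun i : Bool => if i then aPerm else bPerm).ker =
      Subgroup.normalClosure
        {w : FreeGroup Bool | ∃ k : ℕ,
          w = commutatorWord (commutatorWord ((FreeGroup.of true) ^ 2 ^ k) ((FreeGroup.of false) ^ 2 ^ k))
                ((FreeGroup.of false) ^ 2 ^ k) ∨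
          w = commutatorWord (commutatorWord ((FreeGroup.of false) ^ 2 ^ k) ((FreeGroup.of true) ^ 2 ^ (k + 1)))
                ((FreeGroup.of true) ^ 2 ^ (k + 1))} := by
  constructor
  · rw [FreeGroup.range_lift_eq_closure]
    congr 1
    ext f
    simp [or_comm]
  · apply le_antisymm
    · intro x hx
      exact mem_normalClosure_of_evalTree _ x rfl hx
    · exact Subgroup.normalClosure_le_normal fun w hw => evalTree_relators hw
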